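/- arXiv:1506.01886 — 10 statements merged into one kernel-verified Lean document; each statement's English description precedes it below -/
import Mathlib

section
/- There exists an r-circular coloring of the plane for r = 4 + 4√3/3; i.e., there is a function c : ℝ² → [0, 4 + 4√3/3) such that any two points p, q at Euclidean distance exactly 1 satisfy 1 ≤ |c(p) − c(q)| ≤ 3 + 4√3/3. Consequently, the circular chromatic number of the unit-distance graph of the plane is at most 4 + 4√3/3 ≈ 6.3095. -/
/-- Euclidean distance between two points of the plane (given as pairs of reals). -/
noncomputable def euclDist (p q : ℝ × ℝ) : ℝ :=
  Real.sqrt ((p.1 - q.1) ^ 2 + (p.2 - q.2) ^ 2)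

/-- If `u - v` is at distance at least `1` from every multiple of `r`, then the representatives of
`u` and `v` in `[0, r)` differ by at least `1` and at most `r - 1`. -/
theorem abs_toIcoMod_sub_mem {r : ℝ} (hr : 0 < r) {u v : ℝ} (m : ℤ)
    (h₁ : m * r + 1 ≤ u - v) (h₂ : u - v ≤ (m + 1) * r - 1) :
    1 ≤ |toIcoMod hr 0 u - toIcoMod hr 0 v| ∧
      |toIcoMod hr 0 u - toIcoMod hr 0 v| ≤ r - 1 := by
  have hu := toIcoMod_mem_Ico hr 0 u
  have hv := toIcoMod_mem_Ico hr 0 v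
  have eu := toIcoMod_add_toIcoDiv_zsmul hr 0 u
  have ev := toIcoMod_add_toIcoDiv_zsmul hr 0 v
  rw [zsmul_eq_mul] at eu ev
  rw [zero_add] at hu hv
  generalize toIcoMod hr 0 u = a at *
  generalize toIcoMod hr 0 v = b at *
  generalize toIcoDiv hr 0 u = k at *
  generalize toIcoDiv hr 0 v = l at *
  obtain ⟨hu₀, hu₁⟩ := hu
  obtain ⟨hv₀, hv₁⟩ := hv
  obtain ⟨n, hn⟩ : ∃ n : ℤ, n = k - l - m := ⟨_, rfl⟩
  have hn' : (n : ℝ) = k - l - m := by rw [hn]; push_cast; ring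
  have hD : a - b = u - v - m * r - n * r := by rw [hn']; linarith
  have hn₀ : -1 < n := by
    have : (-1 : ℝ) < n := by
      by_contra! hc
      nlinarith
    exact_mod_cast this
  have hn₁ : n < 2 := by
    have : (n : ℝ) < 2 := by
      by_contra! hc
      nlinarith
    exact_mod_cast this
  obtain rfl | rfl : n = 0 ∨ n = 1 := by lia
  · push_cast at hD
    rw [abs_of_nonneg (by linarith)]
    constructor <;> linarith
  · push_cast at hD
    rw [abs_of_nonpos (by linarith)]
    constructor <;> linarith

/-- The coloring by horizontal strips of height `1/2`: with `α = 2√3/3`, the color grows linearly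
at rate `α` along each strip and is shifted by `3 + α` from each strip to the next one, modulo
`4 + 2α`. -/
theorem strip_coloring_sub_mem {α : ℝ} (hα : 0 < α) (hα₂ : α ^ 2 = 4 / 3)
    (hr : 0 < 4 + 2 * α) {x y x' y' : ℝ} (h : (x - x') ^ 2 + (y - y') ^ 2 = 1)
    (hle : ⌊2 * y'⌋ ≤ ⌊2 * y⌋) :
    1 ≤ |toIcoMod hr 0 (α * x + (3 + α) * ⌊2 * y⌋) -
        toIcoMod hr 0 (α * x' + (3 + α) * ⌊2 * y'⌋)| ∧
      |toIcoMod hr 0 (α * x + (3 + α) * ⌊2 * y⌋) -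
        toIcoMod hr 0 (α * x' + (3 + α) * ⌊2 * y'⌋)| ≤ 4 + 2 * α - 1 := by
  have f₁ := Int.floor_le (2 * y)
  have f₂ := Int.lt_floor_add_one (2 * y)
  have g₁ := Int.floor_le (2 * y')
  have g₂ := Int.lt_floor_add_one (2 * y')
  generalize ⌊2 * y⌋ = k at *
  generalize ⌊2 * y'⌋ = l at *
  have hd : |x - x'| ≤ 1 := by
    rw [← sq_le_one_iff_abs_le_one]
    nlinarith [sq_nonneg (y - y')]
  obtain ⟨hd₀, hd₁⟩ := abs_le.1 hd
  have hy : |y - y'| ≤ 1 := by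
    rw [← sq_le_one_iff_abs_le_one]
    nlinarith [sq_nonneg (x - x')]
  obtain ⟨hy₀, hy₁⟩ := abs_le.1 hy
  obtain ⟨j, rfl⟩ : ∃ j : ℤ, k = l + j := ⟨k - l, by ring⟩
  push_cast at *
  have hj : j < 3 := by
    have : (j : ℝ) < 3 := by linarith
    exact_mod_cast this
  have hsq : (α * (x - x')) ^ 2 = 4 / 3 * (x - x') ^ 2 := by rw [mul_pow, hα₂]
  obtain rfl | rfl | rfl : j = 0 ∨ j = 1 ∨ j = 2 := by lia
  · push_cast at *
    have : 1 ≤ |α * (x - x')| := by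
      rw [← one_le_sq_iff_one_le_abs, hsq]
      nlinarith
    obtain h' | h' := le_abs.1 this
    · exact abs_toIcoMod_sub_mem hr 0 (by push_cast; linarith) (by push_cast; nlinarith)
    · exact abs_toIcoMod_sub_mem hr (-1) (by push_cast; nlinarith) (by push_cast; linarith)
  · push_cast at *
    exact abs_toIcoMod_sub_mem hr 0 (by push_cast; nlinarith) (by push_cast; nlinarith)
  · push_cast at *
    have : |α * (x - x')| ≤ 1 := by
      rw [← sq_le_one_iff_abs_le_one, hsq]
      nlinarith
    obtain ⟨h', h''⟩ := abs_le.1 this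
    exact abs_toIcoMod_sub_mem hr 1 (by push_cast; linarith) (by push_cast; linarith)

/-- There exists a `(4 + 4√3/3)`-circular coloring of the plane: a function
`c : ℝ² → [0, 4 + 4√3/3)` such that any two points at Euclidean distance exactly 1
receive colors whose difference lies in `[1, 3 + 4√3/3]`. -/
theorem exists_circular_coloring_plane :
    ∃ c : ℝ × ℝ → ℝ,
      (∀ p : ℝ × ℝ, 0 ≤ c p ∧ c p < 4 + 4 * Real.sqrt 3 / 3) ∧
      (∀ p q : ℝ × ℝ, euclDist p q = 1 →
        1 ≤ |c p - c q| ∧ |c p - c q| ≤ 3 + 4 * Real.sqrt 3 / 3) := by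
  obtain ⟨α, hα⟩ : ∃ α : ℝ, α = 2 * Real.sqrt 3 / 3 := ⟨_, rfl⟩
  have hα₀ : 0 < α := by rw [hα]; positivity
  have hα₂ : α ^ 2 = 4 / 3 := by
    rw [hα, div_pow, mul_pow, Real.sq_sqrt (by norm_num)]
    norm_num
  have hr : 0 < 4 + 2 * α := by positivity
  have e₁ : 4 + 4 * Real.sqrt 3 / 3 = 4 + 2 * α := by rw [hα]; ring
  have e₂ : 3 + 4 * Real.sqrt 3 / 3 = 4 + 2 * α - 1 := by rw [hα]; ring
  rw [e₁, e₂]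
  refine ⟨fun p => toIcoMod hr 0 (α * p.1 + (3 + α) * ⌊2 * p.2⌋), fun p => ?_, fun p q h => ?_⟩
  · simpa using toIcoMod_mem_Ico hr 0 (α * p.1 + (3 + α) * ⌊2 * p.2⌋)
  · rw [euclDist, Real.sqrt_eq_one] at h
    obtain hle | hle := le_total ⌊2 * q.2⌋ ⌊2 * p.2⌋
    · exact strip_coloring_sub_mem hα₀ hα₂ hr h hle
    · rw [abs_sub_comm]
      exact strip_coloring_sub_mem hα₀ hα₂ hr (by linarith) hle
end

section
/- For any two points (x₁, y₁), (x₂, y₂) ∈ ℝ² at Euclidean distance exactly 1, the function c(x, y) = (2√3/3)·(x − (2+√3)·⌊y⌋_{1/2})_ℓ with ℓ = 2 + 2√3 satisfies 1 ≤ |c(x₁, y₁) − c(x₂, y₂)| ≤ 3 + 4√3/3. -/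
/-- `⌊t⌋_ℓ = ⌊t/ℓ⌋·ℓ`, the floor of `t` to a multiple of `ℓ`. -/
noncomputable def flr (ℓ t : ℝ) : ℝ := ⌊t / ℓ⌋ * ℓ

/-- `(t)_ℓ = t − ⌊t⌋_ℓ`, the remainder of `t` modulo `ℓ`. -/
noncomputable def frc (ℓ t : ℝ) : ℝ := t - flr ℓ t

/-- The coloring `c(x,y) = (2√3/3)·(x − (2+√3)·⌊y⌋_{1/2})_ℓ` with `ℓ = 2 + 2√3`. -/
noncomputable def col (x y : ℝ) : ℝ :=
  (2 * Real.sqrt 3 / 3) *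
    frc (2 + 2 * Real.sqrt 3) (x - (2 + Real.sqrt 3) * flr (1 / 2) y)

theorem frc_nonneg {ℓ : ℝ} (hℓ : 0 < ℓ) (t : ℝ) : 0 ≤ frc ℓ t := by
  have := (le_div_iff₀ hℓ).1 (Int.floor_le (t / ℓ))
  unfold frc flr
  linarith

theorem frc_lt {ℓ : ℝ} (hℓ : 0 < ℓ) (t : ℝ) : frc ℓ t < ℓ := by
  have := (div_lt_iff₀ hℓ).1 (Int.lt_floor_add_one (t / ℓ))
  unfold frc flr
  linarith

theorem exists_frc_sub_frc (ℓ a b : ℝ) : ∃ j : ℤ, frc ℓ a - frc ℓ b = a - b + j * ℓ := by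
  refine ⟨⌊b / ℓ⌋ - ⌊a / ℓ⌋, ?_⟩
  unfold frc flr
  push_cast
  ring

/-- If `a - b` stays at distance at least `r` from `0` and `±ℓ`, so does the difference of the
remainders of `a` and `b` modulo `ℓ`. -/
theorem abs_frc_sub_frc_mem_Icc {ℓ r a b : ℝ} (hr : 0 < r)
    (h : |a - b| ∈ Set.Icc r (ℓ - r)) : |frc ℓ a - frc ℓ b| ∈ Set.Icc r (ℓ - r) := by
  obtain ⟨h₁, h₂⟩ := h
  have hℓ : 0 < ℓ := by linarith
  have ha₀ := frc_nonneg hℓ a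
  have ha₁ := frc_lt hℓ a
  have hb₀ := frc_nonneg hℓ b
  have hb₁ := frc_lt hℓ b
  obtain ⟨j, hj⟩ := exists_frc_sub_frc ℓ a b
  obtain ⟨h₃, h₄⟩ := abs_le.1 h₂
  have hj₁ : j < 2 := by
    have : (j : ℝ) < 2 := lt_of_mul_lt_mul_right (by linarith) hℓ.le
    exact_mod_cast this
  have hj₂ : -2 < j := by
    have : (-2 : ℝ) < j := lt_of_mul_lt_mul_right (by linarith) hℓ.le
    exact_mod_cast this
  rw [Set.mem_Icc, le_abs, abs_le]
  rw [le_abs] at h₁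
  interval_cases j <;> norm_num at hj <;> rcases h₁ with h₁ | h₁
  · exact ⟨Or.inr (by linarith), by linarith, by linarith⟩
  · linarith
  · exact ⟨Or.inl (by linarith), by linarith, by linarith⟩
  · exact ⟨Or.inr (by linarith), by linarith, by linarith⟩
  · linarith
  · exact ⟨Or.inl (by linarith), by linarith, by linarith⟩

/-- Shifting the first coordinate of a unit vector `(u, v)` by `1 + √3 / 2` for each half-unit
strip crossed keeps it at distance at least `√3 / 2` from `0` and `±(2 + 2√3)`. -/
theorem abs_sub_strip_shift_mem_Icc {u v : ℝ} {m : ℤ} (h : u ^ 2 + v ^ 2 = 1)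
    (hm₁ : 2 * v - 1 < m) (hm₂ : m < 2 * v + 1) :
    |u - (2 + √3) * (m / 2)| ∈ Set.Icc (√3 / 2) (2 + 2 * √3 - √3 / 2) := by
  have hs : √3 ^ 2 = 3 := Real.sq_sqrt (by norm_num)
  have hs₀ : 0 < √3 := by positivity
  obtain ⟨hu₁, hu₂⟩ := abs_le.1 (abs_le_one_iff_mul_self_le_one.2 (by nlinarith) : |u| ≤ 1)
  obtain ⟨hv₁, hv₂⟩ := abs_le.1 (abs_le_one_iff_mul_self_le_one.2 (by nlinarith) : |v| ≤ 1)
  have hm₃ : m < 3 := by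
    have : (m : ℝ) < 3 := by linarith
    exact_mod_cast this
  have hm₄ : -3 < m := by
    have : (-3 : ℝ) < m := by linarith
    exact_mod_cast this
  have hsmall (hv : 1 / 4 ≤ v ^ 2) : -(√3 / 2) ≤ u ∧ u ≤ √3 / 2 :=
    abs_le.1 (abs_le_of_sq_le_sq (by nlinarith) (by positivity))
  rw [Set.mem_Icc, le_abs, abs_le]
  interval_cases m <;> norm_num at hm₁ hm₂ ⊢
  · obtain ⟨_, _⟩ := hsmall (by nlinarith)
    exact ⟨Or.inl (by linarith), by linarith, by linarith⟩
  · exact ⟨Or.inl (by linarith), by linarith, by linarith⟩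
  · refine ⟨le_abs.1 (abs_le_of_sq_le_sq' ?_ ?_).2, by linarith, by linarith⟩
    · rw [sq_abs]
      nlinarith
    · positivity
  · exact ⟨Or.inr (by linarith), by linarith, by linarith⟩
  · obtain ⟨_, _⟩ := hsmall (by nlinarith)
    exact ⟨Or.inr (by linarith), by linarith, by linarith⟩

/-- For any two points at Euclidean distance exactly 1, the coloring `col`
gives colors whose difference lies in `[1, 3 + 4√3/3]`. -/
theorem col_diff_of_dist_one (x₁ y₁ x₂ y₂ : ℝ)
    (h : euclDist (x₁, y₁) (x₂, y₂) = 1) :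
    1 ≤ |col x₁ y₁ - col x₂ y₂| ∧ |col x₁ y₁ - col x₂ y₂| ≤ 3 + 4 * Real.sqrt 3 / 3 := by
  have hs : √3 ^ 2 = 3 := Real.sq_sqrt (by norm_num)
  have hs₀ : 0 < √3 := by positivity
  have hd : (x₁ - x₂) ^ 2 + (y₁ - y₂) ^ 2 = 1 := Real.sqrt_eq_one.1 h
  have hshift := abs_sub_strip_shift_mem_Icc (m := ⌊y₁ / (1 / 2)⌋ - ⌊y₂ / (1 / 2)⌋) hd
    (by
      push_cast
      linarith [Int.lt_floor_add_one (y₁ / (1 / 2)), Int.floor_le (y₂ / (1 / 2))])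
    (by
      push_cast
      linarith [Int.floor_le (y₁ / (1 / 2)), Int.lt_floor_add_one (y₂ / (1 / 2))])
  obtain ⟨h₁, h₂⟩ := abs_frc_sub_frc_mem_Icc (ℓ := 2 + 2 * √3) (r := √3 / 2)
    (a := x₁ - (2 + √3) * flr (1 / 2) y₁) (b := x₂ - (2 + √3) * flr (1 / 2) y₂)
    (by positivity) (by
      convert hshift using 2
      unfold flr
      push_cast
      ring)
  unfold col
  rw [← mul_sub, abs_mul, abs_of_pos (by positivity : 0 < 2 * √3 / 3)]
  constructor <;> nlinarith
end

section
/- Let (x₁, y₁), (x₂, y₂) ∈ ℝ² and suppose (x₁ − (2+√3)·⌊y₁⌋_{1/2})_ℓ ≥ (x₂ − (2+√3)·⌊y₂⌋_{1/2})_ℓ where ℓ = 2 + 2√3. Then, for the coloring c(x, y) = (2√3/3)·(x − (2+√3)·⌊y⌋_{1/2})_ℓ, one has |c(x₁ − x₂, y₁ − ⌊y₂⌋_{1/2}) − c(0, y₂ − ⌊y₂⌋_{1/2})| = |c(x₁, y₁) − c(x₂, y₂)| (translation invariance of color differences under shifting by (x₂, ⌊y₂⌋_{1/2})). -/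
theorem flr_sub_flr {ℓ : ℝ} (hℓ : 0 < ℓ) (t s : ℝ) :
    flr ℓ (t - flr ℓ s) = flr ℓ t - flr ℓ s := by
  unfold flr
  rw [sub_div, mul_div_cancel_right₀ _ hℓ.ne', Int.floor_sub_intCast]
  push_cast
  ring

theorem frc_eq_fract_mul {ℓ : ℝ} (hℓ : 0 < ℓ) (t : ℝ) : frc ℓ t = Int.fract (t / ℓ) * ℓ := by
  rw [frc, flr, Int.fract, sub_mul, div_mul_cancel₀ _ hℓ.ne']

theorem frc_zero (ℓ : ℝ) : frc ℓ 0 = 0 := by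
  simp [frc, flr]

/-- Remainders subtract without wrap-around when the subtrahend has the smaller remainder. -/
theorem frc_sub_of_le {ℓ a b : ℝ} (hℓ : 0 < ℓ) (h : frc ℓ b ≤ frc ℓ a) :
    frc ℓ (a - b) = frc ℓ a - frc ℓ b := by
  simp only [frc_eq_fract_mul hℓ] at h ⊢
  have hab := le_of_mul_le_mul_right h hℓ
  rw [← sub_mul]
  congr 1
  rw [Int.fract_eq_iff]
  refine ⟨sub_nonneg.2 hab, ?_, ⌊a / ℓ⌋ - ⌊b / ℓ⌋, ?_⟩
  · linarith [Int.fract_lt_one (a / ℓ), Int.fract_nonneg (b / ℓ)]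
  · rw [Int.fract, Int.fract]
    push_cast
    ring

/-- Translation invariance of color differences under shifting by `(x₂, ⌊y₂⌋_{1/2})`. -/
theorem col_diff_translation (x₁ y₁ x₂ y₂ : ℝ)
    (h : frc (2 + 2 * Real.sqrt 3) (x₁ - (2 + Real.sqrt 3) * flr (1 / 2) y₁) ≥
         frc (2 + 2 * Real.sqrt 3) (x₂ - (2 + Real.sqrt 3) * flr (1 / 2) y₂)) :
    |col (x₁ - x₂) (y₁ - flr (1 / 2) y₂) - col 0 (y₂ - flr (1 / 2) y₂)| =
      |col x₁ y₁ - col x₂ y₂| := by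
  have half_pos : (0 : ℝ) < 1 / 2 := by norm_num
  have period_pos : (0 : ℝ) < 2 + 2 * Real.sqrt 3 := by positivity
  have key := frc_sub_of_le period_pos h
  unfold col
  rw [flr_sub_flr half_pos, flr_sub_flr half_pos, sub_self, mul_zero, sub_zero, frc_zero,
    mul_zero, sub_zero, ← mul_sub, ← key]
  congr 3
  ring
end

section
/- (Case 1) Let (x₁, y₁) ∈ ℝ² and y₂ ∈ [0, 1/2) with the Euclidean distance between (x₁, y₁) and (0, y₂) equal to 1. If ⌊y₁⌋_{1/2} = 0 and x₁ > 0, then √3/2 < x₁ ≤ 1 and the coloring c(x, y) = (2√3/3)·(x − (2+√3)·⌊y⌋_{1/2})_ℓ with ℓ = 2 + 2√3 satisfies 1 ≤ c(x₁, y₁) ≤ 3 + 4√3/3. -/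
/-- Case analysis for the circular coloring of the plane. -/
theorem col_case1 (x₁ y₁ y₂ : ℝ) (hy₂0 : 0 ≤ y₂) (hy₂1 : y₂ < 1 / 2)
    (hd : euclDist (x₁, y₁) (0, y₂) = 1)
    (hfl : flr (1 / 2) y₁ = 0) (hx : 0 < x₁) :
    (Real.sqrt 3 / 2 < x₁ ∧ x₁ ≤ 1) ∧
    (1 ≤ col x₁ y₁ ∧ col x₁ y₁ ≤ 3 + 4 * Real.sqrt 3 / 3) := by
  have hs : Real.sqrt 3 ^ 2 = 3 := Real.sq_sqrt (by norm_num)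
  have hs0 : 0 < Real.sqrt 3 := by positivity
  have hy : 0 ≤ y₁ ∧ y₁ < 1 / 2 := by
    have h : ⌊y₁ / (1 / 2)⌋ = 0 := by simpa [flr] using hfl
    rw [Int.floor_eq_zero_iff, Set.mem_Ico] at h
    constructor <;> linarith [h.1, h.2]
  have hd' : x₁ ^ 2 + (y₁ - y₂) ^ 2 = 1 := by
    simpa [euclDist, Real.sqrt_eq_one] using hd
  have hsq : (y₁ - y₂) ^ 2 < (1 / 2) ^ 2 :=
    sq_lt_sq' (by linarith [hy.1]) (by linarith [hy.2])
  have hlo : Real.sqrt 3 / 2 < x₁ := lt_of_pow_lt_pow_left₀ 2 hx.le (by linarith)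
  have hhi : x₁ ≤ 1 := by nlinarith [sq_nonneg (y₁ - y₂)]
  have hfrc : frc (2 + 2 * Real.sqrt 3) x₁ = x₁ := by
    have h : ⌊x₁ / (2 + 2 * Real.sqrt 3)⌋ = 0 := by
      rw [Int.floor_eq_zero_iff, Set.mem_Ico, div_lt_one (by positivity)]
      exact ⟨by positivity, by linarith⟩
    simp [frc, flr, h]
  refine ⟨⟨hlo, hhi⟩, ?_⟩
  rw [col, hfl, mul_zero, sub_zero, hfrc]
  constructor <;> nlinarith
end

section
/- (Case 2) Let (x₁, y₁) ∈ ℝ² and y₂ ∈ [0, 1/2) with the Euclidean distance between (x₁, y₁) and (0, y₂) equal to 1. If ⌊y₁⌋_{1/2} = 0 and x₁ < 0, then −1 ≤ x₁ < −√3/2 and the coloring c(x, y) = (2√3/3)·(x − (2+√3)·⌊y⌋_{1/2})_ℓ with ℓ = 2 + 2√3 satisfies 1 ≤ c(x₁, y₁) ≤ 3 + 4√3/3. -/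
theorem frc_eq_add_self {ℓ t : ℝ} (h₁ : -ℓ ≤ t) (h₂ : t < 0) : frc ℓ t = t + ℓ := by
  have hℓ : 0 < ℓ := by linarith
  have hfloor : ⌊t / ℓ⌋ = -1 := by
    rw [Int.floor_eq_iff, le_div_iff₀ hℓ, div_lt_iff₀ hℓ]
    constructor <;> push_cast <;> linarith
  simp [frc, flr, hfloor]

theorem mem_Ico_of_flr_eq_zero {ℓ t : ℝ} (hℓ : 0 < ℓ) (h : flr ℓ t = 0) :
    t ∈ Set.Ico 0 ℓ := by
  have hfloor : ⌊t / ℓ⌋ = 0 := by simpa [flr, hℓ.ne'] using h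
  rw [Int.floor_eq_zero_iff, Set.mem_Ico, le_div_iff₀ hℓ, div_lt_iff₀ hℓ] at hfloor
  simpa using hfloor

/-- Case analysis for the circular coloring of the plane. -/
theorem col_case2 (x₁ y₁ y₂ : ℝ) (hy₂0 : 0 ≤ y₂) (hy₂1 : y₂ < 1 / 2)
    (hd : euclDist (x₁, y₁) (0, y₂) = 1)
    (hfl : flr (1 / 2) y₁ = 0) (hx : x₁ < 0) :
    (-1 ≤ x₁ ∧ x₁ < -(Real.sqrt 3 / 2)) ∧
    (1 ≤ col x₁ y₁ ∧ col x₁ y₁ ≤ 3 + 4 * Real.sqrt 3 / 3) := by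
  obtain ⟨hy₁0, hy₁1⟩ := mem_Ico_of_flr_eq_zero (by norm_num) hfl
  have hs : √3 * √3 = 3 := Real.mul_self_sqrt (by norm_num)
  have hs1 : 1 < √3 := by rw [Real.lt_sqrt] <;> norm_num
  have hsq : x₁ ^ 2 + (y₁ - y₂) ^ 2 = 1 := by simpa [euclDist] using hd
  have hx1 : -1 ≤ x₁ := by nlinarith [sq_nonneg (y₁ - y₂)]
  have hx2 : x₁ < -(√3 / 2) := by
    have hy : (y₁ - y₂) ^ 2 < 1 / 4 := by nlinarith
    nlinarith
  have hcol : col x₁ y₁ = 2 * √3 / 3 * (x₁ + (2 + 2 * √3)) := by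
    rw [col, hfl, mul_zero, sub_zero, frc_eq_add_self (by linarith) hx]
  rw [hcol]
  exact ⟨⟨hx1, hx2⟩, by nlinarith, by nlinarith⟩
end

section
/- (Case 3) Let (x₁, y₁) ∈ ℝ² and y₂ ∈ [0, 1/2) with the Euclidean distance between (x₁, y₁) and (0, y₂) equal to 1. If ⌊y₁⌋_{1/2} = 1/2, then −1 ≤ x₁ ≤ 1 and the coloring c(x, y) = (2√3/3)·(x − (2+√3)·⌊y⌋_{1/2})_ℓ with ℓ = 2 + 2√3 satisfies 1 ≤ c(x₁, y₁) ≤ 3 + 4√3/3. -/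
/-- If `t + n * ℓ` lies in `[0, ℓ)`, it is the remainder of `t` modulo `ℓ`. -/
theorem frc_eq_add_of_mem_Ico {ℓ t : ℝ} (n : ℤ) (h₀ : 0 ≤ t + n * ℓ) (h₁ : t + n * ℓ < ℓ) :
    frc ℓ t = t + n * ℓ := by
  have hℓ : 0 < ℓ := h₀.trans_lt h₁
  have hfloor : ⌊t / ℓ⌋ = -n := by
    rw [Int.floor_eq_iff, le_div_iff₀ hℓ, div_lt_iff₀ hℓ]
    push_cast
    constructor <;> linarith
  rw [frc, flr, hfloor]
  push_cast
  ring

/-- Case analysis for the circular coloring of the plane. -/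
theorem col_case3 (x₁ y₁ y₂ : ℝ) (hy₂0 : 0 ≤ y₂) (hy₂1 : y₂ < 1 / 2)
    (hd : euclDist (x₁, y₁) (0, y₂) = 1)
    (hfl : flr (1 / 2) y₁ = 1 / 2) :
    (-1 ≤ x₁ ∧ x₁ ≤ 1) ∧
    (1 ≤ col x₁ y₁ ∧ col x₁ y₁ ≤ 3 + 4 * Real.sqrt 3 / 3) := by
  have hx : -1 ≤ x₁ ∧ x₁ ≤ 1 := by
    rw [euclDist, Real.sqrt_eq_one] at hd
    exact abs_le.mp (abs_le_one_iff_mul_self_le_one.mpr (by nlinarith [sq_nonneg (y₁ - y₂)]))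
  obtain ⟨hx₀, hx₁⟩ := hx
  have h3 : √(3 : ℝ) * √3 = 3 := Real.mul_self_sqrt (by norm_num)
  have hpos : 0 < √(3 : ℝ) := by positivity
  have hone : 1 < √(3 : ℝ) := by nlinarith
  have hcol : col x₁ y₁ = 2 * √3 / 3 * (x₁ + 1) + 3 := by
    rw [col, hfl, frc_eq_add_of_mem_Ico 1 (by push_cast; linarith) (by push_cast; linarith)]
    push_cast
    linear_combination h3
  rw [hcol]
  refine ⟨⟨hx₀, hx₁⟩, ?_, ?_⟩ <;> nlinarith
end

section
/- (Case 4) Let (x₁, y₁) ∈ ℝ² and y₂ ∈ [0, 1/2) with the Euclidean distance between (x₁, y₁) and (0, y₂) equal to 1. If ⌊y₁⌋_{1/2} = 1, then −√3/2 ≤ x₁ ≤ √3/2 and the coloring c(x, y) = (2√3/3)·(x − (2+√3)·⌊y⌋_{1/2})_ℓ with ℓ = 2 + 2√3 satisfies 1 ≤ c(x₁, y₁) ≤ 3 + 4√3/3. -/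
theorem flr_le {ℓ : ℝ} (hℓ : 0 < ℓ) (t : ℝ) : flr ℓ t ≤ t :=
  (le_div_iff₀ hℓ).mp (Int.floor_le (t / ℓ))

theorem frc_eq_sub_of_mem {ℓ t : ℝ} {n : ℤ} (hl : n * ℓ ≤ t) (hu : t < (n + 1) * ℓ) :
    frc ℓ t = t - n * ℓ := by
  have hℓ : 0 < ℓ := by linarith
  have hn : ⌊t / ℓ⌋ = n :=
    Int.floor_eq_iff.mpr ⟨(le_div_iff₀ hℓ).mpr hl, (div_lt_iff₀ hℓ).mpr hu⟩
  rw [frc, flr, hn]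

/-- Case analysis for the circular coloring of the plane. -/
theorem col_case4 (x₁ y₁ y₂ : ℝ) (hy₂0 : 0 ≤ y₂) (hy₂1 : y₂ < 1 / 2)
    (hd : euclDist (x₁, y₁) (0, y₂) = 1)
    (hfl : flr (1 / 2) y₁ = 1) :
    (-(Real.sqrt 3 / 2) ≤ x₁ ∧ x₁ ≤ Real.sqrt 3 / 2) ∧
    (1 ≤ col x₁ y₁ ∧ col x₁ y₁ ≤ 3 + 4 * Real.sqrt 3 / 3) := by
  have hs0 : 0 < Real.sqrt 3 := by positivity
  have hs2 : Real.sqrt 3 ^ 2 = 3 := Real.sq_sqrt (by norm_num)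
  have hy1 : 1 ≤ y₁ := by
    have h := flr_le (ℓ := 1 / 2) (by norm_num) y₁
    rwa [hfl] at h
  simp only [euclDist, sub_zero, Real.sqrt_eq_one] at hd
  have hx : |x₁| ≤ Real.sqrt 3 / 2 := by
    refine abs_le_of_sq_le_sq ?_ (by positivity)
    nlinarith
  obtain ⟨hxl, hxu⟩ := abs_le.mp hx
  have hc : col x₁ y₁ = 2 * Real.sqrt 3 / 3 * (x₁ + Real.sqrt 3) := by
    rw [col, hfl, frc_eq_sub_of_mem (n := -1)]
    · push_cast
      ring
    · push_cast
      linarith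
    · push_cast
      linarith
  refine ⟨⟨hxl, hxu⟩, ?_⟩
  rw [hc]
  constructor <;> nlinarith
end

section
/- (Case 5) Let (x₁, y₁) ∈ ℝ² and y₂ ∈ [0, 1/2) with the Euclidean distance between (x₁, y₁) and (0, y₂) equal to 1. If ⌊y₁⌋_{1/2} = −1/2, then −1 ≤ x₁ ≤ 1 and the coloring c(x, y) = (2√3/3)·(x − (2+√3)·⌊y⌋_{1/2})_ℓ with ℓ = 2 + 2√3 satisfies 1 ≤ c(x₁, y₁) ≤ 3 + 4√3/3. -/
/-- A number in `[0, ℓ)` is its own remainder modulo `ℓ`. -/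
theorem frc_eq_self {ℓ t : ℝ} (h0 : 0 ≤ t) (h1 : t < ℓ) : frc ℓ t = t := by
  have hℓ : 0 < ℓ := h0.trans_lt h1
  have hfloor : ⌊t / ℓ⌋ = 0 :=
    Int.floor_eq_zero_iff.mpr ⟨div_nonneg h0 hℓ.le, (div_lt_one hℓ).mpr h1⟩
  simp [frc, flr, hfloor]

/-- The horizontal distance of two points is at most their Euclidean distance. -/
theorem abs_fst_sub_fst_le_euclDist (p q : ℝ × ℝ) : |p.1 - q.1| ≤ euclDist p q :=
  Real.abs_le_sqrt (le_add_of_nonneg_right (sq_nonneg _))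

/-- Case analysis for the circular coloring of the plane. -/
theorem col_case5 (x₁ y₁ y₂ : ℝ) (hy₂0 : 0 ≤ y₂) (hy₂1 : y₂ < 1 / 2)
    (hd : euclDist (x₁, y₁) (0, y₂) = 1)
    (hfl : flr (1 / 2) y₁ = -(1 / 2)) :
    (-1 ≤ x₁ ∧ x₁ ≤ 1) ∧
    (1 ≤ col x₁ y₁ ∧ col x₁ y₁ ≤ 3 + 4 * Real.sqrt 3 / 3) := by
  have hx : -1 ≤ x₁ ∧ x₁ ≤ 1 := by
    have h := abs_fst_sub_fst_le_euclDist (x₁, y₁) (0, y₂)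
    rw [hd] at h
    simpa [abs_le] using h
  have hs : Real.sqrt 3 * Real.sqrt 3 = 3 := Real.mul_self_sqrt (by norm_num)
  have hs0 : 0 ≤ Real.sqrt 3 := Real.sqrt_nonneg 3
  refine ⟨hx, ?_⟩
  obtain ⟨hx₁, hx₂⟩ := hx
  rw [col, hfl, frc_eq_self (by linarith) (by nlinarith)]
  constructor <;> nlinarith
end

section
/- (Case 6) Let (x₁, y₁) ∈ ℝ² and y₂ ∈ [0, 1/2) with the Euclidean distance between (x₁, y₁) and (0, y₂) equal to 1. If ⌊y₁⌋_{1/2} = −1, then −√3/2 ≤ x₁ ≤ √3/2 and the coloring c(x, y) = (2√3/3)·(x − (2+√3)·⌊y⌋_{1/2})_ℓ with ℓ = 2 + 2√3 satisfies 1 ≤ c(x₁, y₁) ≤ 3 + 4√3/3. -/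
/-- Case analysis for the circular coloring of the plane. -/
theorem col_case6 (x₁ y₁ y₂ : ℝ) (hy₂0 : 0 ≤ y₂) (hy₂1 : y₂ < 1 / 2)
    (hd : euclDist (x₁, y₁) (0, y₂) = 1)
    (hfl : flr (1 / 2) y₁ = -1) :
    (-(Real.sqrt 3 / 2) ≤ x₁ ∧ x₁ ≤ Real.sqrt 3 / 2) ∧
    (1 ≤ col x₁ y₁ ∧ col x₁ y₁ ≤ 3 + 4 * Real.sqrt 3 / 3) := by
  have h3 : Real.sqrt 3 * Real.sqrt 3 = 3 := Real.mul_self_sqrt (by norm_num)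
  have hs0 : 0 ≤ Real.sqrt 3 := Real.sqrt_nonneg 3
  have hcirc : x₁ ^ 2 + (y₁ - y₂) ^ 2 = 1 := by
    simpa [euclDist, Real.sqrt_eq_one] using hd
  have hfloor : ⌊y₁ / (1 / 2)⌋ = -2 := by
    have h : (⌊y₁ / (1 / 2)⌋ : ℝ) = -2 := by unfold flr at hfl; linarith
    exact_mod_cast h
  have hy₁ : y₁ < -(1 / 2) := by
    have h := Int.lt_floor_add_one (y₁ / (1 / 2))
    rw [hfloor] at h
    push_cast at h
    linarith
  have hx_sq : x₁ ^ 2 ≤ (Real.sqrt 3 / 2) ^ 2 := by nlinarith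
  obtain ⟨hx_lower, hx_upper⟩ := abs_le_of_sq_le_sq' hx_sq (by positivity)
  have hcol : col x₁ y₁ = 2 * Real.sqrt 3 / 3 * (x₁ + (2 + Real.sqrt 3)) := by
    have hzero : ⌊(x₁ - (2 + Real.sqrt 3) * -1) / (2 + 2 * Real.sqrt 3)⌋ = 0 := by
      rw [Int.floor_eq_zero_iff, Set.mem_Ico]
      have hpos : 0 < 2 + 2 * Real.sqrt 3 := by positivity
      constructor
      · exact div_nonneg (by linarith) hpos.le
      · rw [div_lt_one hpos]
        nlinarith
    rw [col, hfl, frc, flr, hzero]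
    push_cast
    ring
  refine ⟨⟨hx_lower, hx_upper⟩, ?_⟩
  rw [hcol]
  constructor <;> nlinarith
end

section
/- There exists a 7-circular coloring of the plane for the distance interval [10/11, 12/11]; i.e., there is a function c : ℝ² → [0, 7) such that any two points p, q whose Euclidean distance lies in [10/11, 12/11] satisfy 1 ≤ |c(p) − c(q)| ≤ 6. -/
/-- The triangle inequality in the plane, in terms of squared norms. -/
lemma sq_add_sq_add_le {A B x y z w : ℝ} (hA : 0 ≤ A) (hB : 0 ≤ B)
    (h₁ : x ^ 2 + y ^ 2 ≤ A ^ 2) (h₂ : z ^ 2 + w ^ 2 ≤ B ^ 2) :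
    (x + z) ^ 2 + (y + w) ^ 2 ≤ (A + B) ^ 2 := by
  have h : x * z + y * w ≤ A * B := by
    apply le_of_sq_le_sq _ (mul_nonneg hA hB)
    calc (x * z + y * w) ^ 2 ≤ (x ^ 2 + y ^ 2) * (z ^ 2 + w ^ 2) := by
          nlinarith [sq_nonneg (x * w - y * z)]
      _ ≤ A ^ 2 * B ^ 2 := by gcongr
      _ = (A * B) ^ 2 := by ring
  nlinarith

/-- The lattice spanned by `(77/100, 0)` and `(77/200, 67/100)` has covering radius at most
`9/20`. -/
lemma exists_lattice_point_near (p : ℝ × ℝ) :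
    ∃ m n : ℤ, (p.1 - 77 / 100 * (m + n / 2)) ^ 2 + (p.2 - 67 / 100 * n) ^ 2
      ≤ (9 / 20 : ℝ) ^ 2 := by
  obtain ⟨x, y⟩ := p
  obtain ⟨b, hb⟩ : ∃ b : ℝ, y = 67 / 100 * b := ⟨y * (100 / 67), by ring⟩
  obtain ⟨a, ha⟩ : ∃ a : ℝ, x = 77 / 100 * (a + b / 2) := ⟨x * (100 / 77) - b / 2, by ring⟩
  obtain ⟨u, hu⟩ : ∃ u : ℝ, u = Int.fract a := ⟨_, rfl⟩
  obtain ⟨v, hv⟩ : ∃ v : ℝ, v = Int.fract b := ⟨_, rfl⟩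
  have hu₀ : 0 ≤ u := hu ▸ Int.fract_nonneg a
  have hu₁ : u ≤ 1 := hu ▸ (Int.fract_lt_one a).le
  have hv₀ : 0 ≤ v := hv ▸ Int.fract_nonneg b
  have hv₁ : v ≤ 1 := hv ▸ (Int.fract_lt_one b).le
  have ha' : a = ⌊a⌋ + u := by rw [hu, Int.floor_add_fract]
  have hb' : b = ⌊b⌋ + v := by rw [hv, Int.floor_add_fract]
  by_contra! H
  have h₀₀ := H ⌊a⌋ ⌊b⌋
  have h₁₀ := H (⌊a⌋ + 1) ⌊b⌋
  have h₀₁ := H ⌊a⌋ (⌊b⌋ + 1)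
  have h₁₁ := H (⌊a⌋ + 1) (⌊b⌋ + 1)
  generalize (⌊a⌋ : ℤ) = i at *
  generalize (⌊b⌋ : ℤ) = j at *
  subst hb ha
  push_cast at h₀₀ h₁₀ h₀₁ h₁₁
  clear H hu hv
  subst ha' hb'
  ring_nf at h₀₀ h₁₀ h₀₁ h₁₁
  rcases le_total (u + v) 1 with h | h
  · nlinarith [mul_le_mul_of_nonneg_left h₀₀.le (sub_nonneg.2 h),
      mul_le_mul_of_nonneg_left h₁₀.le hu₀, mul_le_mul_of_nonneg_left h₀₁.le hv₀,
      sq_nonneg (u + v / 2 - 1 / 2), sq_nonneg (v - 1 / 3)]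
  · nlinarith [mul_le_mul_of_nonneg_left h₁₁.le (sub_nonneg.2 h),
      mul_le_mul_of_nonneg_left h₀₁.le (sub_nonneg.2 hu₁),
      mul_le_mul_of_nonneg_left h₁₀.le (sub_nonneg.2 hv₁),
      sq_nonneg (u + v / 2 - 1), sq_nonneg (v - 2 / 3)]

/-- Nonzero vectors of the sublattice `7 ∣ m + 5 n` of the lattice spanned by `(77/100, 0)` and
`(77/200, 67/100)` have norm at least `2`. -/
lemma eq_zero_of_dvd_of_norm_lt {m n : ℤ} (hmn : 7 ∣ m + 5 * n)
    (h : (77 / 100 * (m + n / 2) : ℝ) ^ 2 + (67 / 100 * n : ℝ) ^ 2 < 4) : m = 0 ∧ n = 0 := by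
  have hZ : 5929 * (2 * m + n) ^ 2 + 17956 * n ^ 2 < 160000 := by
    have : (5929 * (2 * m + n) ^ 2 + 17956 * n ^ 2 : ℝ) < 160000 := by linarith
    exact_mod_cast this
  have hn₁ : -3 < n := by nlinarith [sq_nonneg (2 * m + n)]
  have hn₂ : n < 3 := by nlinarith [sq_nonneg (2 * m + n)]
  have hm₁ : -6 < 2 * m + n := by nlinarith [sq_nonneg n]
  have hm₂ : 2 * m + n < 6 := by nlinarith [sq_nonneg n]
  obtain ⟨k, hk⟩ := hmn
  have hm₃ : -4 ≤ m := by omega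
  have hm₄ : m ≤ 4 := by omega
  interval_cases n <;> interval_cases m <;> omega

/-- There exists a 7-circular coloring of the plane for the distance interval
`[10/11, 12/11]`: a function `c : ℝ² → [0, 7)` such that any two points whose
Euclidean distance lies in `[10/11, 12/11]` satisfy `1 ≤ |c p − c q| ≤ 6`. -/
theorem exists_seven_circular_coloring :
    ∃ c : ℝ × ℝ → ℝ,
      (∀ p : ℝ × ℝ, 0 ≤ c p ∧ c p < 7) ∧
      (∀ p q : ℝ × ℝ,
        10 / 11 ≤ euclDist p q → euclDist p q ≤ 12 / 11 →
        1 ≤ |c p - c q| ∧ |c p - c q| ≤ 6) := by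
  choose m n hmn using exists_lattice_point_near
  have h₀ (p : ℝ × ℝ) : 0 ≤ (m p + 5 * n p) % 7 := Int.emod_nonneg _ (by norm_num)
  have h₇ (p : ℝ × ℝ) : (m p + 5 * n p) % 7 < 7 := Int.emod_lt_of_pos _ (by norm_num)
  refine ⟨fun p => (((m p + 5 * n p) % 7 : ℤ) : ℝ),
    fun p => ⟨Int.cast_nonneg (h₀ p), by dsimp only; exact_mod_cast h₇ p⟩, fun p q hl hu => ?_⟩
  have hne : (m p + 5 * n p) % 7 ≠ (m q + 5 * n q) % 7 := by
    intro heq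
    unfold euclDist at hl hu
    rw [Real.le_sqrt' (by norm_num)] at hl
    rw [Real.sqrt_le_left (by norm_num)] at hu
    have hp := hmn p
    have hq : (-(q.1 - 77 / 100 * (m q + n q / 2))) ^ 2 + (-(q.2 - 67 / 100 * n q)) ^ 2
        ≤ (9 / 20 : ℝ) ^ 2 := by simpa only [neg_sq] using hmn q
    have hpq := sq_add_sq_add_le (by norm_num) (by norm_num) hp hq
    have hpq' : (-(p.1 - q.1)) ^ 2 + (-(p.2 - q.2)) ^ 2 ≤ (12 / 11 : ℝ) ^ 2 := by
      simpa only [neg_sq] using hu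
    have hsum := sq_add_sq_add_le (by norm_num) (by norm_num) hpq hpq'
    have hzero : m p - m q = 0 ∧ n p - n q = 0 := by
      apply eq_zero_of_dvd_of_norm_lt
      · omega
      · push_cast
        nlinarith
    have hm : m p = m q := by omega
    have hn : n p = n q := by omega
    rw [hm, hn] at hpq
    nlinarith
  have hZ : 1 ≤ |(m p + 5 * n p) % 7 - (m q + 5 * n q) % 7| ∧
      |(m p + 5 * n p) % 7 - (m q + 5 * n q) % 7| ≤ 6 :=
    ⟨Int.one_le_abs (sub_ne_zero.2 hne),
      abs_le.2 ⟨by linarith [h₀ p, h₇ q], by linarith [h₀ q, h₇ p]⟩⟩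
  dsimp only
  exact_mod_cast hZ
end
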